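/- Let m ∈ Sym_h(ℤ)∨ be positive semidefinite and φ a weakly holomorphic Jacobi form of weight k and index m. If s ∈ ℝ^h satisfies sᵀms = 0, then φ(τ, z + s z') = φ(τ, z) for all τ ∈ ℍ, z ∈ ℂ^h, z' ∈ ℂ. In particular, if m = diag(m', 0) with m' ∈ Sym_{h-1}(ℤ)∨, then every weakly holomorphic Jacobi form of index m is of the form (τ,z) ↦ φ'(τ, (z₁,…,z_{h−1})) for some weakly holomorphic Jacobi form φ' of weight k and index m'. -/

import Mathlib

noncomputable section
open Matrix Complex
open scoped Manifold MatrixGroups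

abbrev SL2Z := Matrix.SpecialLinearGroup (Fin 2) ℤ
abbrev UHP := UpperHalfPlane

/-- `e(x) = exp(2 π i x)`. -/
def eC (x : ℂ) : ℂ := Complex.exp (2 * Real.pi * Complex.I * x)

/-- Coerce a rational matrix to a complex one. -/
def mC {h : ℕ} (m : Matrix (Fin h) (Fin h) ℚ) : Matrix (Fin h) (Fin h) ℂ :=
  m.map fun a => (a : ℂ)

def intVec {h : ℕ} (v : Fin h → ℤ) : Fin h → ℂ := fun i => (v i : ℂ)
def ratVec {h : ℕ} (v : Fin h → ℚ) : Fin h → ℂ := fun i => (v i : ℂ)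

/-- `m ∈ Sym_h(ℤ)∨`: symmetric with integral diagonal and half-integral
off-diagonal entries. -/
def IsJacobiIndex {h : ℕ} (m : Matrix (Fin h) (Fin h) ℚ) : Prop :=
  m.IsSymm ∧ (∀ i, ∃ n : ℤ, m i i = n) ∧ ∀ i j, ∃ n : ℤ, 2 * m i j = n

/-- weight-`k` index-`m` Jacobi slash action of `SL(2,ℤ)`. -/
def jslashSL {h : ℕ} (k : ℤ) (m : Matrix (Fin h) (Fin h) ℚ)
    (φ : UHP → (Fin h → ℂ) → ℂ) (γ : SL2Z) : UHP → (Fin h → ℂ) → ℂ := fun τ z =>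
  let c : ℂ := ((γ 1 0 : ℤ) : ℂ)
  let d : ℂ := ((γ 1 1 : ℤ) : ℂ)
  (c * (τ : ℂ) + d) ^ (-k) * eC (-(c * (z ⬝ᵥ mC m *ᵥ z)) * (c * (τ : ℂ) + d)⁻¹) *
    φ (γ • τ) ((c * (τ : ℂ) + d)⁻¹ • z)

/-- weight-`k` index-`m` Jacobi slash action of a (real) Heisenberg element
`(λ, μ, κ)`. -/
def jslashH {h : ℕ} (m : Matrix (Fin h) (Fin h) ℚ) (φ : UHP → (Fin h → ℂ) → ℂ)
    (lam mu : Fin h → ℂ) (kap : Matrix (Fin h) (Fin h) ℂ) : UHP → (Fin h → ℂ) → ℂ :=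
  fun τ z =>
    eC ((lam ⬝ᵥ mC m *ᵥ lam) * (τ : ℂ) + 2 * (lam ⬝ᵥ mC m *ᵥ z)
        + (mC m * (kap + vecMulVec mu lam)).trace) * φ τ (z + (τ : ℂ) • lam + mu)

/-- The block matrix `(2n, rᵀ; r, 2m)` over `ℝ`. -/
def bigMat {h : ℕ} (m : Matrix (Fin h) (Fin h) ℚ) (n : ℤ) (r : Fin h → ℤ) :
    Matrix (Unit ⊕ Fin h) (Unit ⊕ Fin h) ℝ :=
  Matrix.fromBlocks (Matrix.of fun _ _ => (2 * n : ℝ)) (Matrix.of fun _ j => (r j : ℝ))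
    (Matrix.of fun i _ => (r i : ℝ)) ((2 : ℝ) • m.map fun a => (a : ℝ))

/-- A weakly holomorphic Jacobi form of genus 1, cogenus `h`, weight `k` and
index `m`, bundled with its Fourier coefficients. -/
structure WeakJacobiForm (h : ℕ) (k : ℤ) (m : Matrix (Fin h) (Fin h) ℚ) where
  toFun : UHP → (Fin h → ℂ) → ℂ
  holo_tau : ∀ z, MDifferentiable 𝓘(ℂ) 𝓘(ℂ) fun τ : UHP => toFun τ z
  holo_z : ∀ τ, Differentiable ℂ fun z => toFun τ z
  inv_sl : ∀ γ : SL2Z, jslashSL k m toFun γ = toFun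
  inv_heis : ∀ (lam mu : Fin h → ℤ) (kap : Matrix (Fin h) (Fin h) ℤ),
    ((kap.map fun a => (a : ℚ)) +
      vecMulVec (fun i => (mu i : ℚ)) fun i => (lam i : ℚ)).IsSymm →
    jslashH m toFun (intVec lam) (intVec mu) (kap.map fun a => (a : ℂ)) = toFun
  coeff : ℤ → (Fin h → ℤ) → ℂ
  expansion : ∀ τ z, toFun τ z =
    ∑' p : ℤ × (Fin h → ℤ), coeff p.1 p.2 * eC ((p.1 : ℂ) * (τ : ℂ) + intVec p.2 ⬝ᵥ z)
  bdd_below : ∃ n₀ : ℤ, ∀ n r, n < n₀ → coeff n r = 0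

/-- The Fourier support condition singling out holomorphic Jacobi forms among
weakly holomorphic ones. -/
def WeakJacobiForm.IsHolomorphicJF {h : ℕ} {k : ℤ} {m : Matrix (Fin h) (Fin h) ℚ}
    (φ : WeakJacobiForm h k m) : Prop :=
  ∀ n r, ¬ (bigMat m n r).PosSemidef → φ.coeff n r = 0

/-- Specialization `φ[α,β]` of a Jacobi form to the torsion point `z = ατ + β`. -/
def torsionSpec {h : ℕ} (m : Matrix (Fin h) (Fin h) ℚ) (φ : UHP → (Fin h → ℂ) → ℂ)
    (α β : Fin h → ℚ) : UHP → ℂ :=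
  fun τ => jslashH m φ (ratVec α) (ratVec β) (vecMulVec (ratVec α) (ratVec β)) τ 0

/-- `OrdGE f c` formalizes that the vanishing order of `f` at `i∞` is at least
`c`: the function `f(τ) e(-cτ)` is bounded on `im τ ≥ 1`. -/
def OrdGE (f : UHP → ℂ) (c : ℝ) : Prop :=
  ∃ C : ℝ, ∀ τ : UHP, 1 ≤ τ.im → ‖f τ * Complex.exp (-(2 * Real.pi * Complex.I * c * (τ : ℂ)))‖ ≤ C

/-- The weight-`k` slash action on functions on the upper half plane. -/
def eslash (k : ℤ) (f : UHP → ℂ) (γ : SL2Z) : UHP → ℂ := fun τ =>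
  (((γ 1 0 : ℤ) : ℂ) * (τ : ℂ) + ((γ 1 1 : ℤ) : ℂ)) ^ (-k) * f (γ • τ)

open Filter Topology in
theorem entire_doubly_periodic_const (g : ℂ → ℂ) (hg : Differentiable ℂ g) (τ : UHP)
    (h1 : ∀ w, g (w + 1) = g w) (h2 : ∀ w, g (w + τ) = g w) (a b : ℂ) : g a = g b := by
  apply hg.apply_eq_apply_of_bounded
  have hc : IsCompact ((fun p : ℝ × ℝ => g ((p.1 : ℂ) + p.2 * (τ : ℂ))) ''
      (Set.Icc 0 1 ×ˢ Set.Icc 0 1)) := by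
    apply IsCompact.image (isCompact_Icc.prod isCompact_Icc)
    have := hg.continuous
    fun_prop
  refine hc.isBounded.subset ?_
  rintro _ ⟨w, rfl⟩
  have hτ : τ.im ≠ 0 := τ.im_pos.ne'
  let y : ℝ := w.im / τ.im
  let x : ℝ := w.re - y * τ.re
  have hw : w = (x : ℂ) + y * (τ : ℂ) := by
    apply Complex.ext
    · simp [x]
    · simp only [y, Complex.add_im, Complex.ofReal_im, Complex.mul_im, Complex.ofReal_re]
      have : (τ : ℂ).im = τ.im := rfl
      rw [this]; field_simp; simp
  have p1 : Function.Periodic g 1 := h1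
  have p2 : Function.Periodic g (τ : ℂ) := h2
  refine ⟨(Int.fract x, Int.fract y), ⟨⟨Int.fract_nonneg _, (Int.fract_lt_one _).le⟩,
    ⟨Int.fract_nonneg _, (Int.fract_lt_one _).le⟩⟩, ?_⟩
  have e : ((Int.fract x : ℝ) : ℂ) + ((Int.fract y : ℝ) : ℂ) * (τ : ℂ)
      = w - (⌊x⌋ : ℂ) * 1 - (⌊y⌋ : ℂ) * (τ : ℂ) := by
    rw [hw]; simp only [Int.fract]; push_cast; ring
  show g _ = g w
  rw [e, p2.sub_int_mul_eq, p1.sub_int_mul_eq]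

theorem eC_zero : eC 0 = 1 := by simp [eC]

theorem const_int {h : ℕ} {k : ℤ} {m : Matrix (Fin h) (Fin h) ℚ} (hm : m.IsSymm)
    (φ : WeakJacobiForm h k m) (v : Fin h → ℤ) (hv : mC m *ᵥ intVec v = 0)
    (τ : UHP) (z : Fin h → ℂ) (w : ℂ) :
    φ.toFun τ (z + w • intVec v) = φ.toFun τ z := by
  have hv' : ∀ x, intVec v ⬝ᵥ mC m *ᵥ x = 0 := by
    intro x
    have hs : (mC m)ᵀ = mC m := by
      ext i j; simp [mC, ← hm.apply i j]
    rw [dotProduct_mulVec, ← mulVec_transpose, hs, hv, zero_dotProduct]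
  have ht : ∀ z, φ.toFun τ (z + (τ : ℂ) • intVec v) = φ.toFun τ z := by
    intro z
    have := congrFun (congrFun (φ.inv_heis v 0 0 (by
      ext i j; simp [vecMulVec_apply])) τ) z
    have e0 : (intVec (0 : Fin h → ℤ)) = 0 := by ext; simp [intVec]
    have ek : ((0 : Matrix (Fin h) (Fin h) ℤ).map fun a => (a : ℂ)) = 0 := by ext; simp
    simpa [jslashH, hv', e0, ek, eC_zero] using this
  have h1 : ∀ z, φ.toFun τ (z + intVec v) = φ.toFun τ z := by
    intro z
    have := congrFun (congrFun (φ.inv_heis 0 v 0 (by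
      ext i j; simp [vecMulVec_apply])) τ) z
    have e0 : (intVec (0 : Fin h → ℤ)) = 0 := by ext; simp [intVec]
    have ek : ((0 : Matrix (Fin h) (Fin h) ℤ).map fun a => (a : ℂ)) = 0 := by ext; simp
    simpa [jslashH, e0, ek, eC_zero] using this
  have := entire_doubly_periodic_const (fun w => φ.toFun τ (z + w • intVec v))
    ((φ.holo_z τ).comp (by fun_prop)) τ
    (fun w => by
      show φ.toFun τ _ = φ.toFun τ _
      rw [add_smul, one_smul, ← add_assoc, h1])
    (fun w => by
      show φ.toFun τ _ = φ.toFun τ _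
      rw [add_smul, ← add_assoc, ht]) w 0
  simpa using this

theorem const_rat {h : ℕ} {k : ℤ} {m : Matrix (Fin h) (Fin h) ℚ} (hm : m.IsSymm)
    (φ : WeakJacobiForm h k m) (q : Fin h → ℚ) (hq : m *ᵥ q = 0)
    (τ : UHP) (z : Fin h → ℂ) (w : ℂ) :
    φ.toFun τ (z + w • ratVec q) = φ.toFun τ z := by
  obtain ⟨b, hb⟩ := IsLocalization.exist_integer_multiples_of_finite (nonZeroDivisors ℤ) q
  choose v hv using hb
  have hb0 : ((b : ℤ) : ℂ) ≠ 0 := by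
    exact_mod_cast nonZeroDivisors.ne_zero b.2
  have hv1 : ∀ i, (v i : ℚ) = ((b : ℤ) : ℚ) * q i := by
    intro i; simpa using hv i
  have hv2 : intVec v = ((b : ℤ) : ℂ) • ratVec q := by
    ext i
    simp only [intVec, ratVec, Pi.smul_apply, smul_eq_mul]
    exact_mod_cast congrArg (fun x : ℚ => (x : ℂ)) (hv1 i)
  have hq' : mC m *ᵥ ratVec q = 0 := by
    ext i
    have := congrArg (fun x : ℚ => (x : ℂ)) (congrFun hq i)
    simpa [mulVec, dotProduct, mC, ratVec] using this
  have hv3 : mC m *ᵥ intVec v = 0 := by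
    rw [hv2, mulVec_smul, hq', smul_zero]
  have := const_int hm φ v hv3 τ z (w * ((b : ℤ) : ℂ)⁻¹)
  rw [hv2, smul_smul, mul_assoc, inv_mul_cancel₀ hb0, mul_one] at this
  exact this

theorem const_real {h : ℕ} {k : ℤ} {m : Matrix (Fin h) (Fin h) ℚ} (hm : m.IsSymm)
    (φ : WeakJacobiForm h k m) (s : Fin h → ℝ) (hs : (m.map fun a => (a : ℝ)) *ᵥ s = 0)
    (τ : UHP) (z : Fin h → ℂ) (w : ℂ) :
    φ.toFun τ (z + w • fun i => (s i : ℂ)) = φ.toFun τ z := by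
  classical
  let B := Module.Basis.ofVectorSpace ℚ ℝ
  let q : _ → Fin h → ℚ := fun j i => B.repr (s i) j
  have hq : ∀ j, m *ᵥ q j = 0 := by
    intro j
    ext i
    have h1 : ∑ l, m i l • s l = 0 := by
      have := congrFun hs i
      simpa [mulVec, dotProduct, Rat.smul_def] using this
    have h2 := congrArg (fun x => B.repr x j) h1
    simpa [mulVec, dotProduct, q, Finsupp.finsetSum_apply] using h2
  let J := Finset.univ.biUnion fun i => (B.repr (s i)).support
  have hsum : (fun i => (s i : ℂ)) = ∑ j ∈ J, (B j : ℂ) • ratVec (q j) := by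
    ext i
    have h1 := B.linearCombination_repr (s i)
    rw [Finsupp.linearCombination_apply, Finsupp.sum_of_support_subset (s := J) _
      (Finset.subset_biUnion_of_mem (fun i => (B.repr (s i)).support) (Finset.mem_univ i))
      _ (by simp)] at h1
    rw [← h1]
    simp [ratVec, q, Rat.smul_def, mul_comm]
  rw [hsum]
  generalize J = J
  induction J using Finset.induction_on with
  | empty => simp
  | insert j J hj ih =>
    rw [Finset.sum_insert hj, smul_add, add_comm (w • _), ← add_assoc, smul_smul,
      const_rat hm φ (q j) (hq j), ih]

theorem part_one {h : ℕ} {k : ℤ} {m : Matrix (Fin h) (Fin h) ℚ} (hm : IsJacobiIndex m)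
    (hp : (m.map fun a => (a : ℝ)).PosSemidef)
    (φ : WeakJacobiForm h k m) (s : Fin h → ℝ)
    (hs : s ⬝ᵥ (m.map fun a => (a : ℝ)) *ᵥ s = 0)
    (τ : UHP) (z : Fin h → ℂ) (w : ℂ) :
    φ.toFun τ (z + w • fun i => (s i : ℂ)) = φ.toFun τ z :=
  const_real hm.1 φ s ((hp.dotProduct_mulVec_zero_iff s).1 (by simpa using hs)) τ z w

theorem norm_eC (x : ℂ) : ‖eC x‖ = Real.exp (-(2 * Real.pi * x.im)) := by
  rw [eC, Complex.norm_exp]; simp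

open Filter Topology in
theorem freq_real {P : ℂ → Prop} (hP : ∀ x : ℝ, P x) : ∃ᶠ z in 𝓝[≠] (0 : ℂ), P z := by
  have ht : Tendsto (fun x : ℝ => (x : ℂ)) (𝓝[≠] 0) (𝓝[≠] 0) := by
    apply tendsto_nhdsWithin_of_tendsto_nhds_of_eventually_within
    · exact (Complex.continuous_ofReal.tendsto' 0 0 (by simp)).mono_left nhdsWithin_le_nhds
    · filter_upwards [self_mem_nhdsWithin] with x hx
      simpa using hx
  exact ht.frequently (Eventually.of_forall hP).frequently

open Filter Topology in
theorem summable_or_zero {h : ℕ} {k : ℤ} {m : Matrix (Fin h) (Fin h) ℚ}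
    (φ : WeakJacobiForm h k m) : (∀ τ z, φ.toFun τ z = 0) ∨
    ∀ (τ : UHP) (z : Fin h → ℂ), Summable fun p : ℤ × (Fin h → ℤ) =>
      φ.coeff p.1 p.2 * eC ((p.1 : ℂ) * (τ : ℂ) + intVec p.2 ⬝ᵥ z) := by
  by_contra! hcon
  obtain ⟨⟨τ₁, z₁, h1⟩, τ₀, z₀, h0⟩ := hcon
  apply h1
  have hz : ∀ (τ : UHP) (z : Fin h → ℂ), τ.im = τ₀.im → (∀ i, (z i).im = (z₀ i).im) →
      φ.toFun τ z = 0 := by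
    intro τ z hτ hzi
    rw [φ.expansion]
    apply tsum_eq_zero_of_not_summable
    intro hsum
    apply h0
    rw [← summable_norm_iff] at hsum ⊢
    convert hsum using 2 with p
    rw [norm_mul, norm_mul, norm_eC, norm_eC]
    congr 4
    simp [dotProduct, intVec, hτ, hzi]
  have hz2 : ∀ (τ : UHP) (z : Fin h → ℂ), τ.im = τ₀.im → φ.toFun τ z = 0 := by
    intro τ z hτ
    let u : Fin h → ℂ := fun i => ((z i).re : ℂ) + (z₀ i).im * Complex.I
    let v : Fin h → ℂ := fun i => (((z i).im - (z₀ i).im : ℝ) : ℂ)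
    let g : ℂ → ℂ := fun w => φ.toFun τ (u + w • v)
    have hg : Differentiable ℂ g := (φ.holo_z τ).comp (by fun_prop)
    have hg0 : ∀ x : ℝ, g x = 0 := by
      intro x
      apply hz _ _ hτ
      intro i
      simp [u, v]
    have := (hg.differentiableOn (s := Set.univ)).analyticOnNhd isOpen_univ
    have h2 := this.eqOn_zero_of_preconnected_of_frequently_eq_zero isPreconnected_univ
      (Set.mem_univ 0) (freq_real (P := fun z => g z = 0) hg0) (Set.mem_univ Complex.I)
    have h3 : u + Complex.I • v = z := by
      ext i
      apply Complex.ext <;> simp [u, v]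
    simpa [g, h3] using h2
  have hd := UpperHalfPlane.mdifferentiable_iff.1 (φ.holo_tau z₁)
  have han := hd.analyticOnNhd UpperHalfPlane.isOpen_upperHalfPlaneSet
  have hfr : ∃ᶠ w in 𝓝[≠] τ₀, φ.toFun w z₁ = 0 := by
    have ht : Tendsto (fun x : ℝ => x +ᵥ τ₀) (𝓝[≠] 0) (𝓝[≠] τ₀) := by
      apply tendsto_nhdsWithin_of_tendsto_nhds_of_eventually_within
      · have : Continuous fun x : ℝ => x +ᵥ τ₀ := by
          rw [UpperHalfPlane.isOpenEmbedding_coe.isInducing.continuous_iff]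
          show Continuous fun x : ℝ => ((x +ᵥ τ₀ : UHP) : ℂ)
          simp only [UpperHalfPlane.coe_vadd]
          fun_prop
        exact (this.tendsto' 0 τ₀ (by simp)).mono_left nhdsWithin_le_nhds
      · filter_upwards [self_mem_nhdsWithin] with x hx hx2
        apply hx
        have := congrArg UpperHalfPlane.re hx2
        simpa using this
    exact ht.frequently (Eventually.of_forall fun x => hz2 _ _ (by simp)).frequently
  exact congrFun (UpperHalfPlane.eq_zero_of_frequently (φ.holo_tau z₁) hfr) τ₁

theorem quad_red {h : ℕ} {m : Matrix (Fin (h + 1)) (Fin (h + 1)) ℚ}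
    (H : ∀ i j : Fin (h + 1), i = Fin.last h ∨ j = Fin.last h → m i j = 0)
    (u v : Fin (h + 1) → ℂ) :
    u ⬝ᵥ mC m *ᵥ v = (fun i : Fin h => u i.castSucc) ⬝ᵥ
      mC (m.submatrix Fin.castSucc Fin.castSucc) *ᵥ (fun i : Fin h => v i.castSucc) := by
  have H1 : ∀ i, m i (Fin.last h) = 0 := fun i => H _ _ (Or.inr rfl)
  have H2 : ∀ i, m (Fin.last h) i = 0 := fun i => H _ _ (Or.inl rfl)
  simp [dotProduct, mulVec, Fin.sum_univ_castSucc, mC, H1, H2]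

theorem trace_red {h : ℕ} {m : Matrix (Fin (h + 1)) (Fin (h + 1)) ℚ}
    (H : ∀ i j : Fin (h + 1), i = Fin.last h ∨ j = Fin.last h → m i j = 0)
    (K : Matrix (Fin (h + 1)) (Fin (h + 1)) ℂ) :
    (mC m * K).trace = (mC (m.submatrix Fin.castSucc Fin.castSucc) *
      K.submatrix Fin.castSucc Fin.castSucc).trace := by
  have H1 : ∀ i, m i (Fin.last h) = 0 := fun i => H _ _ (Or.inr rfl)
  have H2 : ∀ i, m (Fin.last h) i = 0 := fun i => H _ _ (Or.inl rfl)
  simp [trace, Matrix.mul_apply, Fin.sum_univ_castSucc, mC, H1, H2]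

/-- Adjoin a zero last coordinate. -/
def ext0 {h : ℕ} {R : Type*} [Zero R] (z : Fin h → R) : Fin (h + 1) → R :=
  Fin.snoc (α := fun _ => R) z 0

theorem ext0_castSucc {h : ℕ} {R : Type*} [Zero R] (z : Fin h → R) (i : Fin h) :
    ext0 z i.castSucc = z i := by simp [ext0]

theorem ext0_last {h : ℕ} {R : Type*} [Zero R] (z : Fin h → R) :
    ext0 z (Fin.last h) = 0 := by simp [ext0]

theorem jslashSL_red {h : ℕ} (k : ℤ) {m : Matrix (Fin (h + 1)) (Fin (h + 1)) ℚ}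
    (H : ∀ i j : Fin (h + 1), i = Fin.last h ∨ j = Fin.last h → m i j = 0)
    (f : UHP → (Fin (h + 1) → ℂ) → ℂ) (g : UHP → (Fin h → ℂ) → ℂ)
    (hfg : ∀ τ z, f τ z = g τ fun i => z i.castSucc) (γ : SL2Z) (τ : UHP)
    (z : Fin (h + 1) → ℂ) :
    jslashSL k m f γ τ z =
      jslashSL k (m.submatrix Fin.castSucc Fin.castSucc) g γ τ fun i => z i.castSucc := by
  simp only [jslashSL, hfg, quad_red H]
  rfl

theorem jslashH_red {h : ℕ} {m : Matrix (Fin (h + 1)) (Fin (h + 1)) ℚ}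
    (H : ∀ i j : Fin (h + 1), i = Fin.last h ∨ j = Fin.last h → m i j = 0)
    (f : UHP → (Fin (h + 1) → ℂ) → ℂ) (g : UHP → (Fin h → ℂ) → ℂ)
    (hfg : ∀ τ z, f τ z = g τ fun i => z i.castSucc)
    (lam mu : Fin (h + 1) → ℂ) (kap : Matrix (Fin (h + 1)) (Fin (h + 1)) ℂ) (τ : UHP)
    (z : Fin (h + 1) → ℂ) :
    jslashH m f lam mu kap τ z =
      jslashH (m.submatrix Fin.castSucc Fin.castSucc) g (fun i => lam i.castSucc)
        (fun i => mu i.castSucc) (kap.submatrix Fin.castSucc Fin.castSucc) τ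
        fun i => z i.castSucc := by
  simp only [jslashH, hfg, quad_red H, trace_red H]
  rfl

/-- The zero form. -/
def zeroForm (h : ℕ) (k : ℤ) (m : Matrix (Fin h) (Fin h) ℚ) : WeakJacobiForm h k m where
  toFun := fun _ _ => 0
  holo_tau := fun z => mdifferentiable_const
  holo_z := fun τ => by fun_prop
  inv_sl := fun γ => by ext; simp [jslashSL]
  inv_heis := fun _ _ _ _ => by ext; simp [jslashH]
  coeff := fun _ _ => 0
  expansion := fun τ z => by simp
  bdd_below := ⟨0, by simp⟩

theorem descend {h : ℕ} {k : ℤ} {m : Matrix (Fin (h + 1)) (Fin (h + 1)) ℚ}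
    (H : ∀ i j : Fin (h + 1), i = Fin.last h ∨ j = Fin.last h → m i j = 0)
    (φ : WeakJacobiForm (h + 1) k m)
    (hc : ∀ τ z, φ.toFun τ z = φ.toFun τ (ext0 fun i => z i.castSucc)) :
    ∃ φ' : WeakJacobiForm h k (m.submatrix Fin.castSucc Fin.castSucc),
      ∀ τ z, φ.toFun τ z = φ'.toFun τ fun i => z i.castSucc := by
  rcases summable_or_zero φ with h0 | hsum
  · exact ⟨zeroForm _ _ _, fun τ z => h0 τ z⟩
  refine ⟨{ toFun := fun τ z => φ.toFun τ (ext0 z)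
            holo_tau := fun z => φ.holo_tau _
            holo_z := fun τ => (φ.holo_z τ).comp ?_
            inv_sl := fun γ => ?_
            inv_heis := fun lam mu kap hk => ?_
            coeff := fun n r => ∑' l : ℤ, φ.coeff n (Fin.snoc (α := fun _ => ℤ) r l)
            expansion := fun τ z => ?_
            bdd_below := ?_ }, hc⟩
  · rw [differentiable_pi]
    intro i
    refine Fin.lastCases ?_ (fun i => ?_) i
    · simp only [ext0_last]; fun_prop
    · simp only [ext0_castSucc]; fun_prop
  · ext τ z
    have := jslashSL_red k H φ.toFun (fun τ z => φ.toFun τ (ext0 z)) hc γ τ (ext0 z)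
    simp only [ext0_castSucc] at this
    rw [← this, φ.inv_sl]
  · ext τ z
    let kap' : Matrix (Fin (h + 1)) (Fin (h + 1)) ℤ := Matrix.of fun i j =>
      ext0 (fun i' => ext0 (fun j' => kap i' j') j) i
    have h1 := φ.inv_heis (ext0 lam) (ext0 mu) kap' (by
      ext i j
      have hk' := fun a b => hk.apply a b
      simp only [Matrix.add_apply, Matrix.map_apply, vecMulVec_apply] at hk'
      refine Fin.lastCases ?_ (fun i => ?_) i <;> refine Fin.lastCases ?_ (fun j => ?_) j <;>
        simp [kap', ext0_last, ext0_castSucc, vecMulVec_apply, hk'])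
    have := jslashH_red H φ.toFun (fun τ z => φ.toFun τ (ext0 z)) hc (intVec (ext0 lam)) (intVec (ext0 mu))
      (kap'.map fun a => (a : ℂ)) τ (ext0 z)
    rw [h1] at this
    rw [this]
    simp only [ext0_castSucc, intVec]
    congr 1
    ext i j
    simp [kap', ext0_castSucc]
  · let e : (ℤ × (Fin h → ℤ)) × ℤ ≃ ℤ × (Fin (h + 1) → ℤ) :=
      (Equiv.prodAssoc _ _ _).trans ((Equiv.refl ℤ).prodCongr
        ((Equiv.prodComm _ _).trans (Fin.snocEquiv fun _ => ℤ)))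
    have he : ∀ p l, e (p, l) = (p.1, Fin.snoc (α := fun _ => ℤ) p.2 l) := fun p l => rfl
    have hs := (e.summable_iff.2 (hsum τ (ext0 z)))
    rw [φ.expansion, ← e.tsum_eq]
    refine (Summable.tsum_prod hs).trans ?_
    congr 1
    ext p
    simp only [he, Function.comp_apply]
    rw [← tsum_mul_right]
    congr 1
    ext l
    congr 3
    simp [dotProduct, Fin.sum_univ_castSucc, intVec, ext0_castSucc, ext0_last]
  · obtain ⟨n₀, hn⟩ := φ.bdd_below
    exact ⟨n₀, fun n r hlt => by simp [hn n _ hlt]⟩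

theorem ascend {h : ℕ} {k : ℤ} {m : Matrix (Fin (h + 1)) (Fin (h + 1)) ℚ}
    (H : ∀ i j : Fin (h + 1), i = Fin.last h ∨ j = Fin.last h → m i j = 0)
    (φ : WeakJacobiForm h k (m.submatrix Fin.castSucc Fin.castSucc)) :
    ∃ φ' : WeakJacobiForm (h + 1) k m,
      ∀ τ z, φ'.toFun τ z = φ.toFun τ fun i => z i.castSucc := by
  refine ⟨{ toFun := fun τ z => φ.toFun τ fun i => z i.castSucc
            holo_tau := fun z => φ.holo_tau _
            holo_z := fun τ => (φ.holo_z τ).comp (by fun_prop)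
            inv_sl := fun γ => ?_
            inv_heis := fun lam mu kap hk => ?_
            coeff := fun n r => if r (Fin.last h) = 0 then φ.coeff n (fun i => r i.castSucc) else 0
            expansion := fun τ z => ?_
            bdd_below := ?_ }, fun _ _ => rfl⟩
  · ext τ z
    rw [jslashSL_red k H _ φ.toFun (fun _ _ => rfl), φ.inv_sl]
  · ext τ z
    rw [jslashH_red H _ φ.toFun (fun _ _ => rfl)]
    exact congrFun (congrFun (φ.inv_heis (fun i => lam i.castSucc) (fun i => mu i.castSucc)
      (kap.submatrix Fin.castSucc Fin.castSucc) (by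
        ext i j; exact hk.apply i.castSucc j.castSucc)) τ) _
  · let g : ℤ × (Fin h → ℤ) → ℤ × (Fin (h + 1) → ℤ) := fun p => (p.1, ext0 p.2)
    have hg : Function.Injective g := by
      rintro ⟨a, r⟩ ⟨b, t⟩ hab
      simp only [g, Prod.mk.injEq] at hab
      refine Prod.ext hab.1 ?_
      ext i
      simpa [ext0_castSucc] using congrFun hab.2 i.castSucc
    rw [φ.expansion, ← hg.tsum_eq]
    · congr 1
      ext p
      simp [g, ext0_castSucc, ext0_last, dotProduct, Fin.sum_univ_castSucc, intVec]
    · rintro ⟨n, r⟩ hr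
      have hr0 : r (Fin.last h) = 0 := by
        by_contra hne
        simp [hne] at hr
      refine ⟨(n, fun i => r i.castSucc), ?_⟩
      refine Prod.ext rfl ?_
      ext i
      refine Fin.lastCases ?_ (fun i => ?_) i <;> simp [g, ext0_castSucc, ext0_last, hr0]
  · obtain ⟨n₀, hn⟩ := φ.bdd_below
    exact ⟨n₀, fun n r hlt => by simp [hn n _ hlt]⟩

/-- For positive semidefinite index `m`, a weakly holomorphic Jacobi form is
constant along null directions `s` of `m`; in particular, for
`m = diag(m', 0)` the weakly holomorphic Jacobi forms of index `m` are exactly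
the pullbacks of those of index `m'` under forgetting the last elliptic
variable. -/
theorem stmt8 :
    (∀ (h : ℕ) (k : ℤ) (m : Matrix (Fin h) (Fin h) ℚ), IsJacobiIndex m →
      (m.map fun a => (a : ℝ)).PosSemidef →
      ∀ φ : WeakJacobiForm h k m, ∀ s : Fin h → ℝ,
        s ⬝ᵥ (m.map fun a => (a : ℝ)) *ᵥ s = 0 →
        ∀ (τ : UHP) (z : Fin h → ℂ) (z' : ℂ),
          φ.toFun τ (z + z' • fun i => (s i : ℂ)) = φ.toFun τ z) ∧
    (∀ (h : ℕ) (k : ℤ) (m : Matrix (Fin (h + 1)) (Fin (h + 1)) ℚ),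
      IsJacobiIndex m → (m.map fun a => (a : ℝ)).PosSemidef →
      (∀ i j : Fin (h + 1), i = Fin.last h ∨ j = Fin.last h → m i j = 0) →
      (∀ φ : WeakJacobiForm (h + 1) k m,
        ∃ φ' : WeakJacobiForm h k (m.submatrix Fin.castSucc Fin.castSucc),
          ∀ τ z, φ.toFun τ z = φ'.toFun τ fun i => z i.castSucc) ∧
      (∀ φ' : WeakJacobiForm h k (m.submatrix Fin.castSucc Fin.castSucc),
        ∃ φ : WeakJacobiForm (h + 1) k m,
          ∀ τ z, φ.toFun τ z = φ'.toFun τ fun i => z i.castSucc)) := by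
  refine ⟨fun h k m hm hp φ s hs τ z z' => part_one hm hp φ s hs τ z z', ?_⟩
  intro h k m hm hp H
  refine ⟨fun φ => descend H φ ?_, fun φ' => ascend H φ'⟩
  intro τ z
  have h1 := part_one hm hp φ (Pi.single (Fin.last h) 1) (by simp [H]) τ
    (ext0 fun i => z i.castSucc) (z (Fin.last h))
  rw [← h1]
  congr 1
  ext i
  refine Fin.lastCases ?_ (fun i => ?_) i <;> simp [ext0_castSucc, ext0_last]
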